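/- arXiv:2409.00901 — 2 statements merged into one kernel-verified Lean document; each statement's English description precedes it below -/
import Mathlib

section
/- Let d ≥ 1, b ≥ 2 an integer, ℓ ∈ ℕ, and 0 < ε < b^{−ℓ}. For every L ∈ ℕ with L ≥ 1 there exists q_d ∈ NN_{d,1}(2d·b^{⌈ℓ/L⌉}, L) such that for every i ∈ I_ℓ and every x ∈ Ω_{i,ε}^ℓ, q_d(x) = ind(i) := Σ_{j=1}^d b^{ℓ(j−1)} i_j. -/
open MeasureTheory ENNReal Finset

noncomputable section

/-- The ReLU activation function. -/
def relu (t : ℝ) : ℝ := max t 0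

/-- `A` is an affine map `ℝ^n → ℝ^m`. -/
def IsAffineMap {n m : ℕ} (A : (Fin n → ℝ) → (Fin m → ℝ)) : Prop :=
  ∃ (M : Matrix (Fin m) (Fin n) ℝ) (c : Fin m → ℝ),
    ∀ x i, A x i = (∑ j, M i j * x j) + c i

/-- Auxiliary definition of the ReLU network class, by recursion on the number
of hidden layers. -/
def NNaux (k W : ℕ) : ℕ → (d : ℕ) → Set ((Fin d → ℝ) → (Fin k → ℝ))
  | 0, _ => {g | IsAffineMap g}
  | (L + 1), d => {g | ∃ N : ℕ, 1 ≤ N ∧ N ≤ W ∧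
      ∃ (A : (Fin d → ℝ) → (Fin N → ℝ)) (h : (Fin N → ℝ) → (Fin k → ℝ)),
        IsAffineMap A ∧ h ∈ NNaux k W L N ∧
        g = fun x => h (fun i => relu (A x i))}

/-- The class `NN_{d,k}(W,L)` of functions `ℝ^d → ℝ^k` computed by fully connected
ReLU networks with width at most `W` and `L` hidden layers. -/
def NN (d k W L : ℕ) : Set ((Fin d → ℝ) → (Fin k → ℝ)) := NNaux k W L d

end

/-- The trimmed subcube `Ω_{i,ε}^ℓ` of the partition of `[0,1)^d` into `b^{dℓ}`
subcubes, where a strip of width `ε` is removed on the right of each coordinate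
(except for the last subcube in each coordinate). -/
def trimmedCell (d b ℓ : ℕ) (ε : ℝ) (i : Fin d → ℕ) : Set (Fin d → ℝ) :=
  {x | ∀ j, if i j < b ^ ℓ - 1
      then (i j : ℝ) / (b : ℝ) ^ ℓ ≤ x j ∧ x j < ((i j : ℝ) + 1) / (b : ℝ) ^ ℓ - ε
      else 1 - ((b : ℝ) ^ ℓ)⁻¹ ≤ x j ∧ x j < 1}

/-- The good region `Ω_{ℓ,ε}`, the union of all trimmed subcubes. -/
def goodRegion (d b ℓ : ℕ) (ε : ℝ) : Set (Fin d → ℝ) :=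
  ⋃ i ∈ {i : Fin d → ℕ | ∀ j, i j < b ^ ℓ}, trimmedCell d b ℓ ε i

/-- The real number `r` lies in the `i`-th of the `M` unit cells of `[0, M)`, trimmed on the right
by `δ` unless it is the last one. -/
def InTrimmedCell (δ : ℝ) (M : ℕ) (r : ℝ) (i : ℕ) : Prop :=
  i < M ∧ (i : ℝ) ≤ r ∧ (i + 1 < M → r < i + 1 - δ)

lemma isAffineMap_linear_add_const {n m : ℕ} (u : Fin m → ((Fin n → ℝ) →ₗ[ℝ] ℝ))
    (c : Fin m → ℝ) : IsAffineMap (fun x s => u s x + c s) := by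
  refine ⟨fun s j => u s (Pi.single j 1), c, fun x s => ?_⟩
  beta_reduce
  rw [LinearMap.pi_apply_eq_sum_univ (u s) x]
  congr 1
  refine Finset.sum_congr rfl fun j _ => ?_
  rw [smul_eq_mul, mul_comm]
  congr 3
  ext k
  simp [Pi.single_apply, eq_comm]

lemma relu_of_nonneg {t : ℝ} (ht : 0 ≤ t) : relu t = t := max_eq_left ht

lemma relu_of_nonpos {t : ℝ} (ht : t ≤ 0) : relu t = 0 := max_eq_right ht

lemma relu_sub_relu_of_inTrimmedCell {δ r : ℝ} {M i T : ℕ} (hδ : 0 < δ)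
    (h : InTrimmedCell δ M r i) (hT : T < M) :
    relu (r - T + δ) - relu (r - T) = if T ≤ i then δ else 0 := by
  obtain ⟨-, hir, hi⟩ := h
  split_ifs with hTi
  · have : (T : ℝ) ≤ i := by exact_mod_cast hTi
    rw [relu_of_nonneg (by linarith), relu_of_nonneg (by linarith)]
    ring
  · have hlt := hi (by omega)
    have : (i : ℝ) + 1 ≤ T := by exact_mod_cast (by omega : i + 1 ≤ T)
    rw [relu_of_nonpos (by linarith), relu_of_nonpos (by linarith), sub_zero]

lemma sum_relu_sub_relu_eq_div {δ r : ℝ} {K D i : ℕ} (hδ : 0 < δ) (hD : 0 < D)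
    (h : InTrimmedCell δ (K * D) r i) :
    ∑ t : Fin (K - 1), δ⁻¹ * (relu (r - ((t + 1 : ℕ) * D : ℕ) + δ)
      - relu (r - ((t + 1 : ℕ) * D : ℕ))) = (i / D : ℕ) := by
  have hdiv : i / D < K := (Nat.div_lt_iff_lt_mul hD).2 h.1
  have hterm (t : Fin (K - 1)) : δ⁻¹ * (relu (r - ((t + 1 : ℕ) * D : ℕ) + δ)
      - relu (r - ((t + 1 : ℕ) * D : ℕ))) = if (t : ℕ) < i / D then 1 else 0 := by
    rw [relu_sub_relu_of_inTrimmedCell hδ h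
      (Nat.mul_lt_mul_of_pos_right (by omega) hD)]
    simp only [← Nat.le_div_iff_mul_le hD, Nat.succ_le_iff]
    split_ifs <;> simp [hδ.ne']
  rw [Finset.sum_congr rfl fun t _ => hterm t,
    Fin.sum_univ_eq_sum_range (fun t => if t < i / D then (1 : ℝ) else 0), ← Finset.sum_filter,
    Finset.sum_const, nsmul_eq_mul, mul_one]
  congr 1
  rw [show (Finset.range (K - 1)).filter (· < i / D) = Finset.range (i / D) by
    ext t; simp only [Finset.mem_filter, Finset.mem_range]; omega, Finset.card_range]

lemma InTrimmedCell.sub_div {δ r : ℝ} {K D i : ℕ} (hD : 0 < D)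
    (h : InTrimmedCell δ (K * D) r i) :
    InTrimmedCell δ D (r - D * (i / D : ℕ)) (i % D) := by
  obtain ⟨hi, hir, hlt⟩ := h
  have hcast : (D : ℝ) * (i / D : ℕ) + (i % D : ℕ) = i := by exact_mod_cast Nat.div_add_mod i D
  refine ⟨Nat.mod_lt i hD, by linarith, fun hmod => ?_⟩
  have hdiv : i / D < K := (Nat.div_lt_iff_lt_mul hD).2 hi
  have : i + 1 < K * D := by
    have h1 := Nat.div_add_mod i D
    have h2 : D * (i / D + 1) ≤ D * K := Nat.mul_le_mul_left D hdiv
    rw [mul_comm K D]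
    linarith
  linarith [hlt this]

/-- With `L` hidden layers, a network can read off the cells of several linear functionals `R j`
at resolution `b ^ p` whenever `p ≤ L * m`, where `m` is the number of digits per layer,
and add their weighted indices to a nonnegative linear functional `α`. -/
lemma exists_mem_NNaux_weighted_index {d b m : ℕ} (hd : 1 ≤ d) (hb : 2 ≤ b) {δ : ℝ} (hδ : 0 < δ)
    (w : Fin d → ℝ) (hw : ∀ j, 0 ≤ w j) (L : ℕ) :
    ∀ (p : ℕ), p ≤ L * m → ∀ (n : ℕ) (R : Fin d → ((Fin n → ℝ) →ₗ[ℝ] ℝ))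
      (α : (Fin n → ℝ) →ₗ[ℝ] ℝ), ∃ h ∈ NNaux 1 (2 * d * b ^ m) L n,
        ∀ (i : Fin d → ℕ) (z : Fin n → ℝ), (∀ j, InTrimmedCell δ (b ^ p) (R j z) (i j)) →
          0 ≤ α z → h z 0 = α z + ∑ j, w j * i j := by
  induction L with
  | zero =>
    intro p hp n R α
    obtain rfl : p = 0 := by omega
    refine ⟨fun z _ => α z + 0, isAffineMap_linear_add_const (fun _ => α) (fun _ => 0), ?_⟩
    intro i z hz _
    have hi (j : Fin d) : i j = 0 := by simpa using (hz j).1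
    simp [hi]
  | succ L ih =>
    intro p hp n R α
    set K := b ^ min p m with hK
    set D := b ^ (p - min p m) with hDdef
    have hD : 0 < D := by positivity
    have hK0 : 1 ≤ K := Nat.one_le_pow _ _ (by omega)
    have hKm : K ≤ b ^ m := Nat.pow_le_pow_right (by omega) (min_le_right _ _)
    have hKD : b ^ p = K * D := by
      rw [hK, hDdef, ← pow_add]; congr 1; omega
    let ι := (Fin d × Fin (K - 1) × Bool) ⊕ (Fin d ⊕ Unit)
    let e : ι ≃ Fin (Fintype.card ι) := Fintype.equivFin ι
    let u : ι → ((Fin n → ℝ) →ₗ[ℝ] ℝ) :=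
      Sum.elim (fun s => R s.1) (Sum.elim R fun _ => α)
    let c : ι → ℝ := Sum.elim
      (fun s => -((s.2.1 + 1 : ℕ) * D : ℕ) + if s.2.2 then δ else 0) 0
    let π (s : ι) : (Fin (Fintype.card ι) → ℝ) →ₗ[ℝ] ℝ := LinearMap.proj (e s)
    let digit (j : Fin d) : (Fin (Fintype.card ι) → ℝ) →ₗ[ℝ] ℝ :=
      ∑ t : Fin (K - 1), δ⁻¹ • (π (.inl (j, t, true)) - π (.inl (j, t, false)))
    obtain ⟨h, hh, hval⟩ := ih (p - min p m) (by rw [Nat.succ_mul] at hp; omega) _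
      (fun j => π (.inr (.inl j)) - (D : ℝ) • digit j)
      (π (.inr (.inr ())) + ∑ j, (w j * D) • digit j)
    have hcard : Fintype.card ι = d * ((K - 1) * 2) + (d + 1) := by simp [ι]
    have hwidth : Fintype.card ι ≤ 2 * d * b ^ m := by
      have h1 : 2 * d * K ≤ 2 * d * b ^ m := Nat.mul_le_mul_left _ hKm
      obtain ⟨K', hK'⟩ : ∃ K', K = K' + 1 := ⟨K - 1, by omega⟩
      rw [hcard]
      rw [hK'] at h1 ⊢
      simp only [Nat.add_sub_cancel]
      linarith
    refine ⟨_, ⟨Fintype.card ι, by omega, hwidth, _, h,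
      isAffineMap_linear_add_const (fun s => u (e.symm s)) (fun s => c (e.symm s)), hh, rfl⟩, ?_⟩
    intro i z hz hα
    rw [hKD] at hz
    set y : Fin (Fintype.card ι) → ℝ := fun s => relu (u (e.symm s) z + c (e.symm s)) with hy
    have hπ (s : ι) : π s y = relu (u s z + c s) := by simp [π, hy]
    have hR (j : Fin d) : π (.inr (.inl j)) y = R j z := by
      rw [hπ]
      simpa [u, c] using relu_of_nonneg ((Nat.cast_nonneg _).trans (hz j).2.1)
    have hacc : π (.inr (.inr ())) y = α z := by
      rw [hπ]
      simpa [u, c] using relu_of_nonneg hα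
    have hdigit (j : Fin d) : digit j y = (i j / D : ℕ) := by
      rw [← sum_relu_sub_relu_eq_div hδ hD (hz j)]
      simp only [digit, LinearMap.sum_apply, LinearMap.smul_apply, LinearMap.sub_apply, hπ,
        smul_eq_mul]
      refine Finset.sum_congr rfl fun t _ => ?_
      simp only [u, c, Sum.elim_inl, if_true, Bool.false_eq_true, if_false, add_zero]
      rw [sub_eq_add_neg (R j z), add_assoc]
    rw [hval (fun j => i j % D) y]
    · simp only [LinearMap.add_apply, LinearMap.sum_apply, LinearMap.smul_apply, hacc, hdigit,
        smul_eq_mul]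
      rw [add_assoc, ← Finset.sum_add_distrib]
      congr 1
      refine Finset.sum_congr rfl fun j _ => ?_
      rw [mul_assoc, ← mul_add]
      congr 1
      exact_mod_cast Nat.div_add_mod (i j) D
    · intro j
      simp only [LinearMap.sub_apply, LinearMap.smul_apply, hR, hdigit, smul_eq_mul]
      exact (hz j).sub_div hD
    · simp only [LinearMap.add_apply, LinearMap.sum_apply, LinearMap.smul_apply, hacc, hdigit,
        smul_eq_mul]
      exact add_nonneg hα (Finset.sum_nonneg fun j _ =>
        mul_nonneg (mul_nonneg (hw j) (Nat.cast_nonneg _)) (Nat.cast_nonneg _))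

lemma inTrimmedCell_of_mem_trimmedCell {d b ℓ : ℕ} (hb : 0 < b) {ε : ℝ} {i : Fin d → ℕ}
    (hi : ∀ j, i j < b ^ ℓ) {x : Fin d → ℝ} (hx : x ∈ trimmedCell d b ℓ ε i) (j : Fin d) :
    InTrimmedCell ((b : ℝ) ^ ℓ * ε) (b ^ ℓ) ((b : ℝ) ^ ℓ * x j) (i j) := by
  have hpos : (0 : ℝ) < (b : ℝ) ^ ℓ := by positivity
  have hxj := hx j
  have hij := hi j
  split_ifs at hxj with hlt
  · refine ⟨hij, ?_, fun _ => ?_⟩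
    · rw [mul_comm]
      exact (div_le_iff₀ hpos).1 hxj.1
    · have := mul_lt_mul_of_pos_left hxj.2 hpos
      rwa [mul_sub, mul_div_cancel₀ _ hpos.ne'] at this
  · refine ⟨hij, ?_, fun h => by omega⟩
    have hle := mul_le_mul_of_nonneg_left hxj.1 hpos.le
    rw [mul_sub, mul_inv_cancel₀ hpos.ne', mul_one] at hle
    have : ((i j : ℕ) : ℝ) + 1 ≤ (b : ℝ) ^ ℓ := by exact_mod_cast hij
    linarith

theorem index_network (d b ℓ L : ℕ) (hd : 1 ≤ d) (hb : 2 ≤ b) (hL : 1 ≤ L)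
    (ε : ℝ) (hε0 : 0 < ε) (hε : ε < (b : ℝ) ^ (-(ℓ : ℤ))) :
    ∃ qd ∈ NN d 1 (2 * d * b ^ ((ℓ + L - 1) / L)) L,
      ∀ i : Fin d → ℕ, (∀ j, i j < b ^ ℓ) →
        ∀ x ∈ trimmedCell d b ℓ ε i,
          qd x 0 = ∑ j : Fin d, (b : ℝ) ^ (ℓ * (j : ℕ)) * (i j : ℝ) := by
  have hb0 : 0 < b := by omega
  have hδ : 0 < (b : ℝ) ^ ℓ * ε := by positivity
  have hdigits : ℓ ≤ L * ((ℓ + L - 1) / L) := by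
    have h1 := Nat.div_add_mod (ℓ + L - 1) L
    have h2 := Nat.mod_lt (ℓ + L - 1) hL
    omega
  obtain ⟨q, hq, hval⟩ := exists_mem_NNaux_weighted_index hd hb hδ
    (fun j : Fin d => (b : ℝ) ^ (ℓ * (j : ℕ))) (fun _ => by positivity) L ℓ hdigits d
    (fun j => (b : ℝ) ^ ℓ • LinearMap.proj j) 0
  refine ⟨q, hq, fun i hi x hx => ?_⟩
  rw [hval i x (inTrimmedCell_of_mem_trimmedCell hb0 hi hx) le_rfl]
  simp
end

section
/- Let d = 2^k for some k ∈ ℕ with k ≥ 1, and let 1 ≤ j ≤ d be an integer. There exists ψ_j ∈ NN_{d,1}(4d, k(k+1)/2) such that for every x ∈ ℝ^d, ψ_j(x) = x_{(j)}, the j-th largest entry of x (counted with multiplicity). -/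
open MeasureTheory ENNReal Finset

/-! ### Affine maps and ReLU networks -/

/-- `f` is an affine functional on `ℝ^n`. -/
def IsAffineFunctional {n : ℕ} (f : (Fin n → ℝ) → ℝ) : Prop :=
  ∃ (v : Fin n → ℝ) (c : ℝ), ∀ x, f x = (∑ j, v j * x j) + c

namespace IsAffineFunctional

variable {n : ℕ} {f g : (Fin n → ℝ) → ℝ}

lemma coord (i : Fin n) : IsAffineFunctional (fun x : Fin n → ℝ => x i) :=
  ⟨Pi.single i 1, 0, fun x => by simp [Pi.single_apply]⟩

lemma const (c : ℝ) : IsAffineFunctional (fun _ : Fin n → ℝ => c) :=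
  ⟨0, c, fun x => by simp⟩

lemma add (hf : IsAffineFunctional f) (hg : IsAffineFunctional g) :
    IsAffineFunctional (fun x => f x + g x) := by
  obtain ⟨v, c, hv⟩ := hf
  obtain ⟨w, b, hw⟩ := hg
  refine ⟨v + w, c + b, fun x => ?_⟩
  simp only [hv, hw, Pi.add_apply, add_mul, Finset.sum_add_distrib]
  ring

lemma const_mul (r : ℝ) (hf : IsAffineFunctional f) : IsAffineFunctional (fun x => r * f x) := by
  obtain ⟨v, c, hv⟩ := hf
  refine ⟨r • v, r * c, fun x => ?_⟩
  simp only [hv, Pi.smul_apply, smul_eq_mul, mul_add, Finset.mul_sum, mul_assoc]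

lemma neg (hf : IsAffineFunctional f) : IsAffineFunctional (fun x => -f x) := by
  simpa using hf.const_mul (-1)

lemma sub (hf : IsAffineFunctional f) (hg : IsAffineFunctional g) :
    IsAffineFunctional (fun x => f x - g x) := by
  simpa only [sub_eq_add_neg] using hf.add hg.neg

lemma sum {ι : Type*} (s : Finset ι) {f : ι → (Fin n → ℝ) → ℝ}
    (hf : ∀ i, IsAffineFunctional (f i)) : IsAffineFunctional (fun x => ∑ i ∈ s, f i x) := by
  classical
  induction s using Finset.induction_on with
  | empty => simpa using const 0
  | insert a s ha ih => simpa only [Finset.sum_insert ha] using (hf a).add ih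

end IsAffineFunctional

lemma isAffineMap_iff {n m : ℕ} {A : (Fin n → ℝ) → (Fin m → ℝ)} :
    IsAffineMap A ↔ ∀ i, IsAffineFunctional (fun x => A x i) := by
  constructor
  · rintro ⟨M, c, h⟩ i
    exact ⟨M i, c i, fun x => h x i⟩
  · intro h
    choose v c hv using h
    exact ⟨v, c, fun x i => hv i x⟩

lemma IsAffineMap.comp {l m n : ℕ} {B : (Fin m → ℝ) → (Fin n → ℝ)} {A : (Fin l → ℝ) → (Fin m → ℝ)}
    (hB : IsAffineMap B) (hA : IsAffineMap A) : IsAffineMap (fun x => B (A x)) := by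
  rw [isAffineMap_iff] at *
  intro i
  obtain ⟨v, c, hv⟩ := hB i
  simp only [hv]
  exact (IsAffineFunctional.sum _ fun j => (hA j).const_mul (v j)).add (.const c)

lemma NNaux_comp_affine {k W L m n : ℕ} {h : (Fin n → ℝ) → (Fin k → ℝ)}
    {A : (Fin m → ℝ) → (Fin n → ℝ)} (hh : h ∈ NNaux k W L n) (hA : IsAffineMap A) :
    (fun x => h (A x)) ∈ NNaux k W L m := by
  cases L with
  | zero => exact IsAffineMap.comp hh hA
  | succ L =>
    obtain ⟨N, h1, hW, A', h', hA', hh', rfl⟩ := hh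
    exact ⟨N, h1, hW, fun x => A' (A x), h', hA'.comp hA, hh', rfl⟩

lemma relu_sub_relu_neg (t : ℝ) : relu t - relu (-t) = t := by
  unfold relu
  rcases le_total t 0 with h | h
  · rw [max_eq_right h, max_eq_left (by linarith)]; ring
  · rw [max_eq_left h, max_eq_right (by linarith)]; ring

lemma add_relu_sub (s t : ℝ) : t + relu (s - t) = max s t := by
  unfold relu
  rcases le_total s t with h | h
  · rw [max_eq_right h, max_eq_right (by linarith)]; ring
  · rw [max_eq_left h, max_eq_left (by linarith)]; ring

lemma sub_relu_sub (s t : ℝ) : s - relu (s - t) = min s t := by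
  unfold relu
  rcases le_total s t with h | h
  · rw [min_eq_left h, max_eq_right (by linarith)]; ring
  · rw [min_eq_right h, max_eq_left (by linarith)]; ring

/-! ### Comparator networks -/

/-- A rearrangement of the coordinates in which each output is the maximum or the minimum of two
fixed inputs. -/
structure IsComparatorLayer {κ : Type} (C : (κ → ℝ) → (κ → ℝ)) : Prop where
  max_or_min : ∀ i, ∃ a b, (∀ y, C y i = max (y a) (y b)) ∨ (∀ y, C y i = min (y a) (y b))
  perm : ∀ y, ∃ σ : Equiv.Perm κ, C y = y ∘ σ

/-- Comparator networks of a given depth, with inputs indexed by `ι` and outputs by `κ`. -/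
inductive IsComparatorNetwork {ι κ : Type} : ℕ → ((ι → ℝ) → (κ → ℝ)) → Prop
  | reindex (e : κ ≃ ι) : IsComparatorNetwork 0 (fun x => x ∘ e)
  | layer {L : ℕ} {F : (ι → ℝ) → (κ → ℝ)} {C : (κ → ℝ) → (κ → ℝ)}
      (hF : IsComparatorNetwork L F) (hC : IsComparatorLayer C) :
      IsComparatorNetwork (L + 1) (fun x => C (F x))

lemma IsComparatorLayer.comp_mem_NNaux {k L d : ℕ} (hd : 1 ≤ d) {C : (Fin d → ℝ) → (Fin d → ℝ)}
    (hC : IsComparatorLayer C) {h : (Fin d → ℝ) → (Fin k → ℝ)} (hh : h ∈ NNaux k (4 * d) L d) :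
    (fun x => h (C x)) ∈ NNaux k (4 * d) (L + 1) d := by
  choose a b hab using hC.max_or_min
  let e : Fin d ⊕ (Fin d ⊕ Fin d) ≃ Fin (d + (d + d)) :=
    (Equiv.sumCongr (Equiv.refl _) finSumFinEquiv).trans finSumFinEquiv
  let A : (Fin d → ℝ) → (Fin (d + (d + d)) → ℝ) := fun x q =>
    Sum.elim x (Sum.elim (fun i => -x i) (fun i => x (a i) - x (b i))) (e.symm q)
  have hA : IsAffineMap A := by
    rw [isAffineMap_iff]
    intro q
    obtain ⟨p, rfl⟩ := e.surjective q
    simp only [A, Equiv.symm_apply_apply]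
    rcases p with i | i | i
    · exact .coord i
    · exact (IsAffineFunctional.coord i).neg
    · exact (IsAffineFunctional.coord (a i)).sub (.coord (b i))
  obtain ⟨B, hB, hBC⟩ : ∃ B : (Fin (d + (d + d)) → ℝ) → (Fin d → ℝ),
      IsAffineMap B ∧ ∀ x, B (fun q => relu (A x q)) = C x := by
    have key : ∀ i, ∃ f : (Fin (d + (d + d)) → ℝ) → ℝ,
        IsAffineFunctional f ∧ ∀ x, f (fun q => relu (A x q)) = C x i := by
      intro i
      rcases hab i with h | h
      · refine ⟨fun z => z (e (.inl (b i))) - z (e (.inr (.inl (b i)))) + z (e (.inr (.inr i))),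
          ((IsAffineFunctional.coord _).sub (.coord _)).add (.coord _), fun x => ?_⟩
        simp [A, h, relu_sub_relu_neg, add_relu_sub]
      · refine ⟨fun z => z (e (.inl (a i))) - z (e (.inr (.inl (a i)))) - z (e (.inr (.inr i))),
          ((IsAffineFunctional.coord _).sub (.coord _)).sub (.coord _), fun x => ?_⟩
        simp [A, h, relu_sub_relu_neg, sub_relu_sub]
    choose f hf hfC using key
    exact ⟨fun z i => f i z, isAffineMap_iff.2 hf, fun x => funext fun i => hfC i x⟩
  exact ⟨d + (d + d), by omega, by omega, A, fun z => h (B z), hA, NNaux_comp_affine hh hB, by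
    simp only [hBC]⟩

/-- Exchange the coordinates of two families so that the larger entries come first. -/
def compareExchange {κ : Type} (y : κ ⊕ κ → ℝ) : κ ⊕ κ → ℝ :=
  Sum.elim (fun i => max (y (.inl i)) (y (.inr i))) (fun i => min (y (.inl i)) (y (.inr i)))

lemma isComparatorLayer_compareExchange {κ : Type} :
    IsComparatorLayer (compareExchange (κ := κ)) where
  max_or_min := by
    rintro (i | i)
    · exact ⟨.inl i, .inr i, .inl fun y => rfl⟩
    · exact ⟨.inl i, .inr i, .inr fun y => rfl⟩
  perm y := by
    classical
    let f : κ ⊕ κ → κ ⊕ κ := fun p =>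
      if y (.inr (p.elim id id)) ≤ y (.inl (p.elim id id)) then p else p.swap
    have hf : Function.Involutive f := by
      rintro (i | i) <;> by_cases h : y (.inr i) ≤ y (.inl i) <;> simp [f, h]
    refine ⟨hf.toPerm, funext ?_⟩
    rintro (i | i) <;> by_cases h : y (.inr i) ≤ y (.inl i)
    · simp [compareExchange, f, h]
    · simp [compareExchange, f, h, (not_le.1 h).le]
    · simp [compareExchange, f, h]
    · simp [compareExchange, f, h, (not_le.1 h).le]

lemma IsComparatorLayer.conj {κ μ : Type} {C : (κ → ℝ) → (κ → ℝ)} (hC : IsComparatorLayer C)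
    (e : μ ≃ κ) : IsComparatorLayer (fun y : μ → ℝ => C (y ∘ e.symm) ∘ e) where
  max_or_min i := by
    obtain ⟨a, b, h⟩ := hC.max_or_min (e i)
    exact ⟨e.symm a, e.symm b, h.imp (fun h y => h _) (fun h y => h _)⟩
  perm y := by
    obtain ⟨σ, hσ⟩ := hC.perm (y ∘ e.symm)
    exact ⟨(e.trans σ).trans e.symm, by rw [hσ]; rfl⟩

lemma IsComparatorLayer.sum {κ μ : Type} {C : (κ → ℝ) → (κ → ℝ)} {D : (μ → ℝ) → (μ → ℝ)}
    (hC : IsComparatorLayer C) (hD : IsComparatorLayer D) :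
    IsComparatorLayer (fun y : κ ⊕ μ → ℝ => Sum.elim (C (y ∘ .inl)) (D (y ∘ .inr))) where
  max_or_min := by
    rintro (i | i)
    · obtain ⟨a, b, h⟩ := hC.max_or_min i
      exact ⟨.inl a, .inl b, h.imp (fun h y => h _) (fun h y => h _)⟩
    · obtain ⟨a, b, h⟩ := hD.max_or_min i
      exact ⟨.inr a, .inr b, h.imp (fun h y => h _) (fun h y => h _)⟩
  perm y := by
    obtain ⟨σ, hσ⟩ := hC.perm (y ∘ .inl)
    obtain ⟨τ, hτ⟩ := hD.perm (y ∘ .inr)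
    refine ⟨Equiv.sumCongr σ τ, ?_⟩
    rw [hσ, hτ]
    ext (i | i) <;> rfl

namespace IsComparatorNetwork

variable {ι κ μ ν : Type} {L M : ℕ} {F : (ι → ℝ) → (κ → ℝ)}

lemma perm (hF : IsComparatorNetwork L F) (x : ι → ℝ) : ∃ σ : κ ≃ ι, F x = x ∘ σ := by
  induction hF with
  | reindex e => exact ⟨e, rfl⟩
  | @layer L F C hF hC ih =>
    obtain ⟨σ, hσ⟩ := ih
    obtain ⟨τ, hτ⟩ := hC.perm (F x)
    exact ⟨τ.trans σ, hτ.trans (by rw [hσ]; rfl)⟩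

lemma comp_equiv (hF : IsComparatorNetwork L F) (e : μ ≃ κ) :
    IsComparatorNetwork L (fun x => F x ∘ e) := by
  induction hF with
  | reindex f => exact .reindex (e.trans f)
  | @layer L F C hF hC ih =>
    convert ih.layer (hC.conj e) using 4
    ext; simp

lemma comp {G : (κ → ℝ) → (μ → ℝ)} (hG : IsComparatorNetwork M G)
    (hF : IsComparatorNetwork L F) : IsComparatorNetwork (L + M) (fun x => G (F x)) := by
  induction hG with
  | reindex e => exact hF.comp_equiv e
  | layer _ hC ih => exact ih.layer hC

lemma sum {G : (μ → ℝ) → (ν → ℝ)} (hF : IsComparatorNetwork L F)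
    (hG : IsComparatorNetwork L G) :
    IsComparatorNetwork L
      (fun x : ι ⊕ μ → ℝ => Sum.elim (F (x ∘ .inl)) (G (x ∘ .inr))) := by
  induction hF generalizing G with
  | reindex e =>
    cases hG with
    | reindex f =>
      convert IsComparatorNetwork.reindex (Equiv.sumCongr e f) using 2
      ext (i | i) <;> rfl
  | layer _ hC ih =>
    cases hG with
    | layer hG hD => exact (ih hG).layer (hC.sum hD)

lemma comp_mem_NNaux {k d : ℕ} (hd : 1 ≤ d) {F : (Fin d → ℝ) → (Fin d → ℝ)}
    (hF : IsComparatorNetwork M F) {h : (Fin d → ℝ) → (Fin k → ℝ)}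
    (hh : h ∈ NNaux k (4 * d) L d) : (fun x => h (F x)) ∈ NNaux k (4 * d) (L + M) d := by
  induction hF generalizing L h with
  | reindex e =>
    exact NNaux_comp_affine hh (isAffineMap_iff.2 fun i => .coord (e i))
  | @layer M F C hF hC ih =>
    have := ih (hC.comp_mem_NNaux hd hh)
    rwa [Nat.add_right_comm] at this

end IsComparatorNetwork

/-! ### Merging and sorting -/

/-- The interleaving of two copies of `Fin N`: the first copy becomes the even positions and the
second copy the odd positions. -/
def interleave (N : ℕ) : Fin N ⊕ Fin N ≃ Fin (2 * N) where
  toFun := Sum.elim (fun i => ⟨2 * i, by omega⟩) (fun i => ⟨2 * i + 1, by omega⟩)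
  invFun p := if p.1 % 2 = 0 then .inl ⟨p / 2, by omega⟩ else .inr ⟨p / 2, by omega⟩
  left_inv := by
    rintro (i | i)
    · simp
    · simp [Nat.add_mod, Fin.ext_iff]
      omega
  right_inv p := by
    by_cases h : p.1 % 2 = 0 <;> simp [h, Fin.ext_iff] <;> omega

lemma interleave_inl_val {N : ℕ} (i : Fin N) : (interleave N (.inl i) : ℕ) = 2 * i := rfl

lemma interleave_inr_val {N : ℕ} (i : Fin N) : (interleave N (.inr i) : ℕ) = 2 * i + 1 := rfl

lemma monotone_interleave_inl (N : ℕ) : Monotone (interleave N ∘ .inl) := fun i j hij => by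
  rw [Fin.le_def] at *
  simp only [Function.comp_apply, interleave_inl_val]
  omega

lemma monotone_interleave_inr (N : ℕ) : Monotone (interleave N ∘ .inr) := fun i j hij => by
  rw [Fin.le_def] at *
  simp only [Function.comp_apply, interleave_inr_val]
  omega

lemma antitone_compareExchange_interleave {N : ℕ} {y : Fin N ⊕ Fin N → ℝ}
    (hl : Antitone (y ∘ .inl)) (hr : Antitone (y ∘ .inr))
    (hlr : ∀ i j, i < j → y (.inr j) ≤ y (.inl i))
    (hrl : ∀ i j, i < j → y (.inl j) ≤ y (.inr i)) :
    Antitone (compareExchange y ∘ (interleave N).symm) := by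
  intro p q hpq
  obtain ⟨p, rfl⟩ := (interleave N).surjective p
  obtain ⟨q, rfl⟩ := (interleave N).surjective q
  simp only [Function.comp_apply, Equiv.symm_apply_apply]
  rw [Fin.le_def] at hpq
  rcases p with i | i <;> rcases q with j | j <;>
    simp only [interleave_inl_val, interleave_inr_val] at hpq <;>
    simp only [compareExchange, Sum.elim_inl, Sum.elim_inr]
  · have hij : i ≤ j := by rw [Fin.le_def]; omega
    exact max_le_max (hl hij) (hr hij)
  · have hij : i ≤ j := by rw [Fin.le_def]; omega
    exact (min_le_left _ _).trans ((hl hij).trans (le_max_left _ _))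
  · have hij : i < j := by rw [Fin.lt_def]; omega
    exact max_le (le_min (hl hij.le) (hrl i j hij)) (le_min (hlr i j hij) (hr hij.le))
  · have hij : i ≤ j := by rw [Fin.le_def]; omega
    exact min_le_min (hl hij) (hr hij)

/-- The number of entries of `x` that are at least `t`. -/
noncomputable def countGE {ι : Type} [Fintype ι] (x : ι → ℝ) (t : ℝ) : ℕ := #{i | t ≤ x i}

lemma countGE_comp_equiv {ι κ : Type} [Fintype ι] [Fintype κ] (x : ι → ℝ) (e : κ ≃ ι) (t : ℝ) :
    countGE (x ∘ e) t = countGE x t := by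
  unfold countGE
  exact Finset.card_equiv e (by simp)

lemma countGE_sum {ι κ : Type} [Fintype ι] [Fintype κ] (x : ι ⊕ κ → ℝ) (t : ℝ) :
    countGE x t = countGE (x ∘ .inl) t + countGE (x ∘ .inr) t := by
  simp only [countGE, Finset.card_filter, Fintype.sum_sum_type, Function.comp_apply]

lemma IsComparatorNetwork.countGE_eq {ι κ : Type} [Fintype ι] [Fintype κ] {L : ℕ}
    {F : (ι → ℝ) → (κ → ℝ)} (hF : IsComparatorNetwork L F) (x : ι → ℝ) (t : ℝ) :
    countGE (F x) t = countGE x t := by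
  obtain ⟨σ, hσ⟩ := hF.perm x
  rw [hσ, countGE_comp_equiv]

lemma countGE_le {N : ℕ} (x : Fin N → ℝ) (t : ℝ) : countGE x t ≤ N :=
  (Finset.card_le_univ _).trans (Fintype.card_fin N).le

lemma Antitone.le_apply_iff_lt_countGE {N : ℕ} {x : Fin N → ℝ} (hx : Antitone x) (t : ℝ)
    (i : Fin N) : t ≤ x i ↔ (i : ℕ) < countGE x t := by
  constructor
  · intro h
    have : Finset.Iic i ⊆ ({i | t ≤ x i} : Finset (Fin N)) := fun j hj =>
      Finset.mem_filter.2 ⟨Finset.mem_univ j, h.trans (hx (Finset.mem_Iic.1 hj))⟩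
    have := Finset.card_le_card this
    rwa [Fin.card_Iic] at this
  · intro h
    by_contra hi
    have : ({i | t ≤ x i} : Finset (Fin N)) ⊆ Finset.Iio i := fun j hj => by
      rw [Finset.mem_Iio]
      by_contra hij
      exact hi ((by simpa using hj : t ≤ x j).trans (hx (not_lt.1 hij)))
    have := Finset.card_le_card this
    rw [Fin.card_Iio] at this
    exact absurd h (not_lt.2 this)

lemma countGE_interleave {N : ℕ} {x : Fin (2 * N) → ℝ} (hx : Antitone x) (t : ℝ) :
    countGE (x ∘ interleave N ∘ .inr) t ≤ countGE (x ∘ interleave N ∘ .inl) t ∧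
    countGE (x ∘ interleave N ∘ .inl) t ≤ countGE (x ∘ interleave N ∘ .inr) t + 1 := by
  have hl : Antitone (x ∘ interleave N ∘ .inl) := hx.comp_monotone (monotone_interleave_inl N)
  have hr : Antitone (x ∘ interleave N ∘ .inr) := hx.comp_monotone (monotone_interleave_inr N)
  have hl' := hl.le_apply_iff_lt_countGE t
  have hr' := hr.le_apply_iff_lt_countGE t
  have bl := countGE_le (x ∘ interleave N ∘ .inl) t
  have br := countGE_le (x ∘ interleave N ∘ .inr) t
  set p := countGE (x ∘ interleave N ∘ .inl) t
  set q := countGE (x ∘ interleave N ∘ .inr) t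
  constructor
  · by_contra! h
    refine absurd ((hl' ⟨p, by omega⟩).1 (((hr' ⟨p, by omega⟩).2 h).trans (hx ?_))) (lt_irrefl p)
    simp [Fin.le_def, interleave_inl_val, interleave_inr_val]
  · by_contra! h
    refine absurd ((hr' ⟨q, by omega⟩).1 (((hl' ⟨q + 1, by omega⟩).2 h).trans (hx ?_)))
      (lt_irrefl q)
    simp only [Fin.le_def, Function.comp_apply, interleave_inl_val, interleave_inr_val]
    omega

/-- There is a comparator network of depth `L` merging two decreasing sequences of length `N`. -/
def HasMerger (N L : ℕ) : Prop :=
  ∃ M : (Fin N ⊕ Fin N → ℝ) → (Fin (2 * N) → ℝ), IsComparatorNetwork L M ∧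
    ∀ x, Antitone (x ∘ .inl) → Antitone (x ∘ .inr) → Antitone (M x)

/-- There is a comparator network of depth `L` sorting sequences of length `N`. -/
def HasSorter (N L : ℕ) : Prop :=
  ∃ S : (Fin N → ℝ) → (Fin N → ℝ), IsComparatorNetwork L S ∧ ∀ x, Antitone (S x)

lemma hasMerger_one : HasMerger 1 1 := by
  refine ⟨fun x => compareExchange x ∘ (interleave 1).symm,
    ((IsComparatorNetwork.reindex (.refl _)).layer
      isComparatorLayer_compareExchange).comp_equiv _, fun x hl hr => ?_⟩
  exact antitone_compareExchange_interleave hl hr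
    (fun i j hij => absurd hij (by simp [Subsingleton.elim i j]))
    (fun i j hij => absurd hij (by simp [Subsingleton.elim i j]))

/-- The wiring which pairs the even entries of each sequence with the odd entries of the other. -/
def crossParity (N : ℕ) :
    (Fin N ⊕ Fin N) ⊕ (Fin N ⊕ Fin N) ≃ Fin (2 * N) ⊕ Fin (2 * N) :=
  (Equiv.sumSumSumComm _ _ _ _).trans
    (Equiv.sumCongr (interleave N) ((Equiv.sumComm _ _).trans (interleave N)))

lemma HasMerger.double {N L : ℕ} (h : HasMerger N L) : HasMerger (2 * N) (L + 1) := by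
  obtain ⟨M, hM, hMa⟩ := h
  have hR := IsComparatorNetwork.reindex (crossParity N)
  have hMM := (hM.sum hM).comp hR
  rw [zero_add] at hMM
  refine ⟨_, (hMM.layer isComparatorLayer_compareExchange).comp_equiv (interleave (2 * N)).symm,
    fun x hl hr => ?_⟩
  have even : ∀ {z : Fin (2 * N) → ℝ}, Antitone z → Antitone (z ∘ interleave N ∘ .inl) :=
    fun hz => hz.comp_monotone (monotone_interleave_inl N)
  have odd : ∀ {z : Fin (2 * N) → ℝ}, Antitone z → Antitone (z ∘ interleave N ∘ .inr) :=
    fun hz => hz.comp_monotone (monotone_interleave_inr N)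
  set u := (x ∘ crossParity N) ∘ Sum.inl
  set v := (x ∘ crossParity N) ∘ Sum.inr
  have hu : Antitone (M u) := hMa u (even hl) (odd hr)
  have hv : Antitone (M v) := hMa v (odd hl) (even hr)
  have count : ∀ t, countGE (M u) t ≤ countGE (M v) t + 1 ∧
      countGE (M v) t ≤ countGE (M u) t + 1 := by
    intro t
    rw [hM.countGE_eq, hM.countGE_eq, countGE_sum u, countGE_sum v]
    have ha := countGE_interleave hl t
    have hb := countGE_interleave hr t
    have hul : u ∘ .inl = (x ∘ .inl) ∘ interleave N ∘ .inl := rfl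
    have hur : u ∘ .inr = (x ∘ .inr) ∘ interleave N ∘ .inr := rfl
    have hvl : v ∘ .inl = (x ∘ .inl) ∘ interleave N ∘ .inr := rfl
    have hvr : v ∘ .inr = (x ∘ .inr) ∘ interleave N ∘ .inl := rfl
    rw [hul, hur, hvl, hvr]
    omega
  refine antitone_compareExchange_interleave hu hv (fun i j hij => ?_) (fun i j hij => ?_)
  · have h := (hv.le_apply_iff_lt_countGE (M v j) j).1 le_rfl
    exact (hu.le_apply_iff_lt_countGE (M v j) i).2 (by have := count (M v j); omega)
  · have h := (hu.le_apply_iff_lt_countGE (M u j) j).1 le_rfl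
    exact (hv.le_apply_iff_lt_countGE (M u j) i).2 (by have := count (M u j); omega)

lemma hasMerger_two_pow (n : ℕ) : HasMerger (2 ^ n) (n + 1) := by
  induction n with
  | zero => exact hasMerger_one
  | succ n ih => rw [pow_succ']; exact ih.double

lemma HasSorter.double {N L M : ℕ} (hS : HasSorter N L) (hM : HasMerger N M) :
    HasSorter (2 * N) (L + M) := by
  obtain ⟨S, hS, hSa⟩ := hS
  obtain ⟨M, hM, hMa⟩ := hM
  have hSS := (hS.sum hS).comp (IsComparatorNetwork.reindex (interleave N))
  rw [zero_add] at hSS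
  exact ⟨_, hM.comp hSS, fun x => hMa _ (hSa _) (hSa _)⟩

lemma hasSorter_two_pow (n : ℕ) : HasSorter (2 ^ n) (n * (n + 1) / 2) := by
  induction n with
  | zero => exact ⟨_, .reindex (.refl _), fun x i j _ =>
      (congrArg x (Subsingleton.elim (α := Fin 1) j i)).le⟩
  | succ n ih =>
    have h : (n + 1) * (n + 1 + 1) / 2 = n * (n + 1) / 2 + (n + 1) := by
      rw [show (n + 1) * (n + 1 + 1) = n * (n + 1) + (n + 1) * 2 by ring,
        Nat.add_mul_div_right _ _ two_pos]
    rw [pow_succ', h]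
    exact ih.double (hasMerger_two_pow n)

theorem order_statistic_network (k : ℕ) (hk : 1 ≤ k) (j : ℕ) (hj1 : 1 ≤ j) (hjd : j ≤ 2 ^ k) :
    ∃ ψ ∈ NN (2 ^ k) 1 (4 * 2 ^ k) (k * (k + 1) / 2),
      ∀ x : Fin (2 ^ k) → ℝ, ∃ e : Equiv.Perm (Fin (2 ^ k)),
        (∀ a b : Fin (2 ^ k), a ≤ b → x (e b) ≤ x (e a)) ∧
        ψ x 0 = x (e ⟨j - 1, by omega⟩) := by
  obtain ⟨S, hS, hSa⟩ := hasSorter_two_pow k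
  have hproj : (fun y (_ : Fin 1) => y ⟨j - 1, by omega⟩) ∈ NNaux 1 (4 * 2 ^ k) 0 (2 ^ k) :=
    isAffineMap_iff.2 fun _ => .coord _
  have hψ := hS.comp_mem_NNaux Nat.one_le_two_pow hproj
  rw [zero_add] at hψ
  refine ⟨_, hψ, fun x => ?_⟩
  obtain ⟨σ, hσ⟩ := hS.perm x
  have ha := hSa x
  rw [hσ] at ha
  exact ⟨σ, fun a b hab => ha hab, by rw [hσ]; rfl⟩
end
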